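/- Fix t ≥ 1 and β_P > 0. Let f_⋆ : C × S × A → [0,1] be a context-dependent reward function, let P_⋆ and P̂_t be context-dependent dynamics, and let π_1, …, π_{t−1} ∈ Π_C be context-dependent policies used to define the bonus b^P_t. Then for every context-dependent policy π ∈ Π_C: | E_c[ V^{π(c;·)}_{M^{(f_⋆,P_⋆)}(c)}(s_0) − V^{π(c;·)}_{M^{(f_⋆,P̂_t)}(c)}(s_0) ] | ≤ E_c[ Σ_{h=0}^{H−1} Σ_{s∈S_h} Σ_{a∈A} q_h(s,a|π(c;·),P̂^c_t) · b^P_t(c,s,a) ] + (78H³/β_P) · E_c[ Σ_{i=1}^{t−1} E_{π_i(c;·),P^c_⋆}[ Σ_{h=0}^{H−1} D_H²(P^c_⋆(·|s_h,a_h), P̂^c_t(·|s_h,a_h)) | s_0 ] ] + H²/(2β_P). -/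

import Mathlib

open scoped BigOperators Classical
open Finset

noncomputable section

/-- Squared Hellinger distance between two distributions on a finite set. -/
def hellingerSq {X : Type*} [Fintype X] (P Q : X → ℝ) : ℝ :=
  ∑ x, (Real.sqrt (P x) - Real.sqrt (Q x)) ^ 2

variable {S : ℕ → Type} [∀ h, Fintype (S h)] {A : Type} [Fintype A]

/-- Value function of a deterministic policy in a layered MDP, defined by the backward
Bellman recursion: `val P r pol k h s` is the value with `k` steps to go, starting at
state `s` in layer `h`.  The layer-`h` value function of the horizon-`H` MDP is
`val P r pol (H - h) h`. -/
def val (P : ∀ h, S h → A → S (h + 1) → ℝ) (r : ∀ h, S h → A → ℝ)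
    (pol : ∀ h, S h → A) : (k : ℕ) → (h : ℕ) → S h → ℝ
  | 0, _, _ => 0
  | k + 1, h, s =>
      r h s (pol h s) + ∑ s' : S (h + 1), P h s (pol h s) s' * val P r pol k (h + 1) s'

/-- State-occupancy measure: `stateOcc P pol h0 st k s` is the probability of being at
state `s` in layer `h0 + k` when acting with the deterministic policy `pol` under
dynamics `P`, starting from state `st` in layer `h0`. -/
def stateOcc (P : ∀ h, S h → A → S (h + 1) → ℝ) (pol : ∀ h, S h → A)
    (h0 : ℕ) (st : S h0) : (k : ℕ) → S (h0 + k) → ℝ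
  | 0, s => if s = st then 1 else 0
  | k + 1, s' =>
      ∑ s : S (h0 + k), stateOcc P pol h0 st k s * P (h0 + k) s (pol (h0 + k) s) s'

/-- State-action occupancy measure started at `st` in layer `h0`. -/
def occ (P : ∀ h, S h → A → S (h + 1) → ℝ) (pol : ∀ h, S h → A)
    (h0 : ℕ) (st : S h0) (k : ℕ) (s : S (h0 + k)) (a : A) : ℝ :=
  if a = pol (h0 + k) s then stateOcc P pol h0 st k s else 0

/-- State-occupancy measure started from the initial state `s0` of layer `0`:
probability of being at state `s` in layer `h`. -/
def stateOcc0 (P : ∀ h, S h → A → S (h + 1) → ℝ) (pol : ∀ h, S h → A)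
    (s0 : S 0) : (h : ℕ) → S h → ℝ
  | 0, s => if s = s0 then 1 else 0
  | h + 1, s' => ∑ s : S h, stateOcc0 P pol s0 h s * P h s (pol h s) s'

/-- State-action occupancy measure `q_h(s, a | pol, P)` started from the initial state. -/
def occ0 (P : ∀ h, S h → A → S (h + 1) → ℝ) (pol : ∀ h, S h → A)
    (s0 : S 0) (h : ℕ) (s : S h) (a : A) : ℝ :=
  if a = pol h s then stateOcc0 P pol s0 h s else 0


variable {C : Type} [Fintype C]

/-- Reward bonus `b^R_t(c,s,a)` built from the past policies `pols 0, …, pols (t-2)`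
(representing `π_1, …, π_{t-1}`) and the approximated dynamics `Phat`. -/
def bonusR (Phat : C → ∀ h, S h → A → S (h + 1) → ℝ)
    (pols : ℕ → C → ∀ h, S h → A) (s0 : S 0) (t : ℕ) (br : ℝ)
    (c : C) (h : ℕ) (s : S h) (a : A) : ℝ :=
  min 1 ((br / 2) / (1 + ∑ i ∈ Finset.range (t - 1), occ0 (Phat c) (pols i c) s0 h s a))

/-- Reward bonus `b^P_t(c,s,a)` built from the past policies `pols 0, …, pols (t-2)`
(representing `π_1, …, π_{t-1}`) and the approximated dynamics `Phat`. -/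
def bonusP (Phat : C → ∀ h, S h → A → S (h + 1) → ℝ)
    (pols : ℕ → C → ∀ h, S h → A) (s0 : S 0) (t : ℕ) (bp : ℝ) (H : ℕ)
    (c : C) (h : ℕ) (s : S h) (a : A) : ℝ :=
  min (H : ℝ)
    ((bp * H / 2) / (1 + ∑ i ∈ Finset.range (t - 1), occ0 (Phat c) (pols i c) s0 h s a))

theorem occ0_sum_eq (P : ∀ h, S h → A → S (h + 1) → ℝ) (pol : ∀ h, S h → A) (s0 : S 0)
    (h : ℕ) (s : S h) (f : A → ℝ) :
    ∑ a : A, occ0 P pol s0 h s a * f a = stateOcc0 P pol s0 h s * f (pol h s) := by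
  simp [occ0, ite_mul]

theorem stateOcc0_nonneg {H : ℕ} {P : ∀ h, S h → A → S (h + 1) → ℝ}
    (hP0 : ∀ h, h < H → ∀ s a s', 0 ≤ P h s a s') (pol : ∀ h, S h → A) (s0 : S 0) :
    ∀ h, h ≤ H → ∀ s, 0 ≤ stateOcc0 P pol s0 h s
  | 0, _, s => by
      unfold stateOcc0
      split_ifs <;> norm_num
  | h + 1, hh, s => by
      unfold stateOcc0
      exact Finset.sum_nonneg fun x _ =>
        mul_nonneg (stateOcc0_nonneg hP0 pol s0 h (by omega) x) (hP0 h (by omega) _ _ _)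

theorem sum_stateOcc0 {H : ℕ} {P : ∀ h, S h → A → S (h + 1) → ℝ}
    (hP1 : ∀ h, h < H → ∀ s a, ∑ s', P h s a s' = 1) (pol : ∀ h, S h → A) (s0 : S 0) :
    ∀ h, h ≤ H → ∑ s, stateOcc0 P pol s0 h s = 1
  | 0, _ => by simp [stateOcc0]
  | h + 1, hh => by
      simp only [stateOcc0]
      rw [Finset.sum_comm]
      simp only [← Finset.mul_sum]
      rw [← sum_stateOcc0 hP1 pol s0 h (by omega)]
      exact Finset.sum_congr rfl fun x _ => by rw [hP1 h (by omega), mul_one]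

theorem sum_stateOcc0_mul_val (P : ∀ h, S h → A → S (h + 1) → ℝ) (r : ∀ h, S h → A → ℝ)
    (pol : ∀ h, S h → A) (s0 : S 0) (k : ℕ) : ∀ h,
    ∑ s, stateOcc0 P pol s0 h s * val P r pol k h s =
      ∑ j ∈ Finset.Ico h (h + k), ∑ s, stateOcc0 P pol s0 j s * r j s (pol j s) := by
  induction k with
  | zero => intro h; simp [_root_.val]
  | succ k ih =>
    intro h
    rw [Finset.sum_eq_sum_Ico_succ_bot (by omega), show h + (k + 1) = h + 1 + k by omega,
      ← ih (h + 1)]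
    simp only [_root_.val, stateOcc0, mul_add, Finset.sum_add_distrib]
    congr 1
    simp only [Finset.mul_sum, Finset.sum_mul]
    rw [Finset.sum_comm]
    simp only [mul_assoc]

theorem val_eq_sum_stateOcc0 (P : ∀ h, S h → A → S (h + 1) → ℝ) (r : ∀ h, S h → A → ℝ)
    (pol : ∀ h, S h → A) (s0 : S 0) (H : ℕ) :
    val P r pol H 0 s0 =
      ∑ h ∈ Finset.range H, ∑ s, stateOcc0 P pol s0 h s * r h s (pol h s) := by
  have := sum_stateOcc0_mul_val P r pol s0 H 0
  rw [zero_add, ← Finset.range_eq_Ico] at this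
  rw [← this]
  simp [stateOcc0]

theorem expect_mem_Icc {X : Type*} [Fintype X] {p V : X → ℝ} {B : ℝ} (hp0 : ∀ x, 0 ≤ p x)
    (hp1 : ∑ x, p x = 1) (hV : ∀ x, 0 ≤ V x ∧ V x ≤ B) :
    0 ≤ ∑ x, p x * V x ∧ ∑ x, p x * V x ≤ B := by
  refine ⟨Finset.sum_nonneg fun x _ => mul_nonneg (hp0 x) (hV x).1, ?_⟩
  calc ∑ x, p x * V x ≤ ∑ x, p x * B :=
        Finset.sum_le_sum fun x _ => mul_le_mul_of_nonneg_left (hV x).2 (hp0 x)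
    _ = B := by rw [← Finset.sum_mul, hp1, one_mul]

theorem val_mem_Icc {H : ℕ} {P : ∀ h, S h → A → S (h + 1) → ℝ} {r : ∀ h, S h → A → ℝ}
    (hP0 : ∀ h, h < H → ∀ s a s', 0 ≤ P h s a s')
    (hP1 : ∀ h, h < H → ∀ s a, ∑ s', P h s a s' = 1)
    (hr : ∀ h, h < H → ∀ s a, 0 ≤ r h s a ∧ r h s a ≤ 1) (pol : ∀ h, S h → A) (k : ℕ) :
    ∀ h, h + k ≤ H → ∀ s, 0 ≤ val P r pol k h s ∧ val P r pol k h s ≤ k := by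
  induction k with
  | zero => intro h _ s; simp [_root_.val]
  | succ k ih =>
    intro h hh s
    have h1 := expect_mem_Icc (hP0 h (by omega) s (pol h s)) (hP1 h (by omega) s (pol h s))
      (ih (h + 1) (by omega))
    have h2 := hr h (by omega) s (pol h s)
    simp only [_root_.val]
    push_cast
    constructor <;> linarith

/-- Simulation lemma: the value difference is the value, under the second dynamics, of the
one-step dynamics error measured against the value function of the first dynamics. -/
theorem val_sub_val (P Q : ∀ h, S h → A → S (h + 1) → ℝ) (r : ∀ h, S h → A → ℝ)
    (pol : ∀ h, S h → A) (H k : ℕ) : ∀ h, h + k = H → ∀ s,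
    val P r pol k h s - val Q r pol k h s =
      val Q (fun h s a => ∑ s', (P h s a s' - Q h s a s') * val P r pol (H - (h + 1)) (h + 1) s')
        pol k h s := by
  induction k with
  | zero => intro h _ s; simp [_root_.val]
  | succ k ih =>
    intro h hh s
    simp only [_root_.val]
    rw [show H - (h + 1) = k by omega]
    rw [← Finset.sum_congr rfl fun s' _ =>
      congrArg (Q h s (pol h s) s' * ·) (ih (h + 1) (by omega) s')]
    simp only [sub_mul, mul_sub, Finset.sum_sub_distrib]
    ring

theorem hellingerSq_nonneg {X : Type*} [Fintype X] (p q : X → ℝ) : 0 ≤ hellingerSq p q :=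
  Finset.sum_nonneg fun _ _ => sq_nonneg _

/-- Squared expectation differences of `[0, B]`-valued functions are bounded by the squared
Hellinger distance. -/
theorem sq_expect_sub_le {X : Type*} [Fintype X] {p q V : X → ℝ} {B : ℝ}
    (hp0 : ∀ x, 0 ≤ p x) (hp1 : ∑ x, p x = 1) (hq0 : ∀ x, 0 ≤ q x) (hq1 : ∑ x, q x = 1)
    (hV : ∀ x, 0 ≤ V x ∧ V x ≤ B) :
    (∑ x, (p x - q x) * V x) ^ 2 ≤ 4 * B ^ 2 * hellingerSq p q := by
  have hcs := Finset.sum_mul_sq_le_sq_mul_sq Finset.univ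
    (fun x => Real.sqrt (p x) - Real.sqrt (q x))
    (fun x => (Real.sqrt (p x) + Real.sqrt (q x)) * V x)
  have h1 : ∀ x, (Real.sqrt (p x) - Real.sqrt (q x)) * ((Real.sqrt (p x) + Real.sqrt (q x)) * V x)
      = (p x - q x) * V x := by
    intro x
    linear_combination V x * Real.sq_sqrt (hp0 x) - V x * Real.sq_sqrt (hq0 x)
  have h2 : ∑ x, ((Real.sqrt (p x) + Real.sqrt (q x)) * V x) ^ 2 ≤ 4 * B ^ 2 := by
    calc ∑ x, ((Real.sqrt (p x) + Real.sqrt (q x)) * V x) ^ 2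
        ≤ ∑ x, (2 * p x + 2 * q x) * B ^ 2 := by
          refine Finset.sum_le_sum fun x _ => ?_
          rw [mul_pow]
          refine mul_le_mul ?_ (pow_le_pow_left₀ (hV x).1 (hV x).2 2) (sq_nonneg _)
            (by linarith [hp0 x, hq0 x])
          nlinarith [Real.sq_sqrt (hp0 x), Real.sq_sqrt (hq0 x),
            sq_nonneg (Real.sqrt (p x) - Real.sqrt (q x))]
      _ = 4 * B ^ 2 := by
          rw [← Finset.sum_mul, Finset.sum_add_distrib, ← Finset.mul_sum, ← Finset.mul_sum,
            hp1, hq1]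
          ring
  simp only [h1] at hcs
  calc _ ≤ _ := hcs
    _ ≤ hellingerSq p q * (4 * B ^ 2) := mul_le_mul_of_nonneg_left h2 (hellingerSq_nonneg p q)
    _ = _ := by ring

/-- Multiplicative change of measure at the price of a squared Hellinger distance. -/
theorem expect_le_expect_add_hellingerSq {X : Type*} [Fintype X] {p q V : X → ℝ} {B L : ℝ}
    (hL : 0 < L) (hp0 : ∀ x, 0 ≤ p x) (hq0 : ∀ x, 0 ≤ q x) (hV : ∀ x, 0 ≤ V x ∧ V x ≤ B) :
    ∑ x, q x * V x ≤ (1 + 1 / L) * ∑ x, p x * V x + (1 + L) * B * hellingerSq p q := by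
  unfold hellingerSq
  rw [Finset.mul_sum, Finset.mul_sum, ← Finset.sum_add_distrib]
  refine Finset.sum_le_sum fun x _ => ?_
  set a := Real.sqrt (p x) with ha
  set b := Real.sqrt (q x) with hb
  have hpa : p x = a ^ 2 := (Real.sq_sqrt (hp0 x)).symm
  have hqb : q x = b ^ 2 := (Real.sq_sqrt (hq0 x)).symm
  have hkey : q x ≤ (1 + 1 / L) * p x + (1 + L) * (a - b) ^ 2 := by
    have : (1 + 1 / L) * p x + (1 + L) * (a - b) ^ 2 - q x = (a + L * (a - b)) ^ 2 / L := by
      rw [hpa, hqb]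
      field_simp
      ring
    have : 0 ≤ (a + L * (a - b)) ^ 2 / L := by positivity
    linarith
  calc q x * V x ≤ ((1 + 1 / L) * p x + (1 + L) * (a - b) ^ 2) * V x :=
        mul_le_mul_of_nonneg_right hkey (hV x).1
    _ = (1 + 1 / L) * (p x * V x) + (1 + L) * (a - b) ^ 2 * V x := by ring
    _ ≤ (1 + 1 / L) * (p x * V x) + (1 + L) * (a - b) ^ 2 * B := by
        gcongr
        exact (hV x).2
    _ = _ := by ring

/-- Change of dynamics for the value of a reward dominated by the squared Hellinger distance. -/
theorem val_le_pow_mul_val_hellingerSq {H : ℕ} (hH : 1 ≤ H)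
    {P Q : ∀ h, S h → A → S (h + 1) → ℝ} {g : ∀ h, S h → A → ℝ}
    (hP0 : ∀ h, h < H → ∀ s a s', 0 ≤ P h s a s')
    (hQ0 : ∀ h, h < H → ∀ s a s', 0 ≤ Q h s a s')
    (hQ1 : ∀ h, h < H → ∀ s a, ∑ s', Q h s a s' = 1)
    (hg : ∀ h, h < H → ∀ s a, 0 ≤ g h s a ∧ g h s a ≤ 1)
    (hgD : ∀ h, h < H → ∀ s a, g h s a ≤ 4 * hellingerSq (P h s a) (Q h s a))
    (pol : ∀ h, S h → A) (k : ℕ) : ∀ h, h + k ≤ H → ∀ s,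
    0 ≤ val P (fun h s a => hellingerSq (P h s a) (Q h s a)) pol k h s ∧
    val Q g pol k h s ≤ (1 + 1 / (H : ℝ)) ^ k * (6 * (H : ℝ) ^ 2) *
      val P (fun h s a => hellingerSq (P h s a) (Q h s a)) pol k h s := by
  have hH1 : (1 : ℝ) ≤ H := by exact_mod_cast hH
  induction k with
  | zero => intro h _ s; simp [_root_.val]
  | succ k ih =>
    intro h hh s
    have hb : ∀ s', 0 ≤ val Q g pol k (h + 1) s' ∧ val Q g pol k (h + 1) s' ≤ H := fun s' => by
      have h1 := val_mem_Icc hQ0 hQ1 hg pol k (h + 1) (by omega) s'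
      have h2 : (k : ℝ) ≤ H := by exact_mod_cast (by omega : k ≤ H)
      exact ⟨h1.1, h1.2.trans h2⟩
    have hp := hP0 h (by omega) s (pol h s)
    have hch := expect_le_expect_add_hellingerSq (L := (H : ℝ)) (by linarith) hp
      (hQ0 h (by omega) s (pol h s)) hb
    have hD := hellingerSq_nonneg (P h s (pol h s)) (Q h s (pol h s))
    have hgs := hgD h (by omega) s (pol h s)
    simp only [_root_.val]
    set W := val P (fun h s a => hellingerSq (P h s a) (Q h s a)) pol k (h + 1) with hW
    set d := hellingerSq (P h s (pol h s)) (Q h s (pol h s)) with hd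
    refine ⟨add_nonneg hD (Finset.sum_nonneg fun x _ =>
      mul_nonneg (hp x) (ih (h + 1) (by omega) x).1), ?_⟩
    set c := 1 + 1 / (H : ℝ) with hc
    have hc1 : 1 ≤ c := by
      have : 0 ≤ 1 / (H : ℝ) := by positivity
      linarith
    have hck : 1 ≤ c ^ (k + 1) := one_le_pow₀ hc1
    have hsum : ∑ x, P h s (pol h s) x * val Q g pol k (h + 1) x ≤
        c ^ k * (6 * (H : ℝ) ^ 2) * ∑ x, P h s (pol h s) x * W x := by
      rw [Finset.mul_sum]
      refine Finset.sum_le_sum fun x _ => ?_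
      calc _ ≤ P h s (pol h s) x * (c ^ k * (6 * (H : ℝ) ^ 2) * W x) :=
            mul_le_mul_of_nonneg_left (ih (h + 1) (by omega) x).2 (hp x)
        _ = _ := by ring
    have hstep : 4 * d + (1 + (H : ℝ)) * H * d ≤ c ^ (k + 1) * (6 * (H : ℝ) ^ 2) * d := by
      have h6 : 4 + (1 + (H : ℝ)) * H ≤ 6 * (H : ℝ) ^ 2 := by nlinarith
      have h7 : 6 * (H : ℝ) ^ 2 ≤ c ^ (k + 1) * (6 * (H : ℝ) ^ 2) :=
        le_mul_of_one_le_left (by positivity) hck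
      nlinarith [mul_le_mul_of_nonneg_right (h6.trans h7) hD]
    have hs2 := mul_le_mul_of_nonneg_left hsum (by linarith : 0 ≤ c)
    rw [mul_add]
    calc _ ≤ 4 * d + (c * (∑ x, P h s (pol h s) x * val Q g pol k (h + 1) x)
              + (1 + (H : ℝ)) * H * d) := add_le_add hgs hch
      _ ≤ c ^ (k + 1) * (6 * (H : ℝ) ^ 2) * d
            + c * (c ^ k * (6 * (H : ℝ) ^ 2) * ∑ x, P h s (pol h s) x * W x) := by linarith
      _ = _ := by ring

theorem one_add_one_div_pow_le_three (H : ℕ) (hH : 1 ≤ H) : (1 + 1 / (H : ℝ)) ^ H ≤ 3 := by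
  have hH1 : (0 : ℝ) < H := by exact_mod_cast hH
  calc (1 + 1 / (H : ℝ)) ^ H ≤ (Real.exp (1 / (H : ℝ))) ^ H := by
        gcongr
        linarith [Real.add_one_le_exp (1 / (H : ℝ))]
    _ = Real.exp 1 := by
        rw [← Real.exp_nat_mul]
        congr 1
        field_simp
    _ ≤ 3 := by linarith [Real.exp_one_lt_d9]

/-- An error `x ≤ H` is at most the bonus plus a weighted squared relative error. -/
theorem le_bonus_add_sq {x H b N : ℝ} (hx : x ≤ H) (hH : 0 < H) (hb : 0 < b) (hN : 0 ≤ N) :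
    x ≤ min H ((b * H / 2) / (1 + N)) + H / (2 * b) * ((x / H) ^ 2 * (1 + N)) := by
  have hnn : 0 ≤ H / (2 * b) * ((x / H) ^ 2 * (1 + N)) := by positivity
  rcases min_choice H ((b * H / 2) / (1 + N)) with h | h
  · rw [h]; linarith
  · rw [h]
    have : (b * H / 2) / (1 + N) + H / (2 * b) * ((x / H) ^ 2 * (1 + N)) - x =
        (b * H - x * (1 + N)) ^ 2 / (2 * b * H * (1 + N)) := by
      field_simp
      ring
    have : 0 ≤ (b * H - x * (1 + N)) ^ 2 / (2 * b * H * (1 + N)) := by positivity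
    linarith

theorem bonus_residual_le {H b X Y : ℝ} (hH : 0 < H) (hb : 0 < b) (hY : Y ≤ 18 * H ^ 2 * X)
    (hX : 0 ≤ X) : H / (2 * b) * (H + Y) ≤ 78 * H ^ 3 / b * X + H ^ 2 / (2 * b) := by
  calc H / (2 * b) * (H + Y) ≤ H / (2 * b) * (H + 18 * H ^ 2 * X) := by gcongr
    _ = 9 * H ^ 3 / b * X + H ^ 2 / (2 * b) := by field_simp; ring
    _ ≤ _ := by gcongr; norm_num

/-- The value difference bound for a single context. -/
theorem abs_val_sub_val_le {H : ℕ} (hH : 1 ≤ H) (s0 : S 0) (n : ℕ) {bp : ℝ} (hbp : 0 < bp)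
    {P Q : ∀ h, S h → A → S (h + 1) → ℝ} {f : ∀ h, S h → A → ℝ}
    (hf : ∀ h s a, 0 ≤ f h s a ∧ f h s a ≤ 1)
    (hP0 : ∀ h, h < H → ∀ s a s', 0 ≤ P h s a s')
    (hP1 : ∀ h, h < H → ∀ s a, ∑ s', P h s a s' = 1)
    (hQ0 : ∀ h, h < H → ∀ s a s', 0 ≤ Q h s a s')
    (hQ1 : ∀ h, h < H → ∀ s a, ∑ s', Q h s a s' = 1)
    (pols : ℕ → ∀ h, S h → A) (pol : ∀ h, S h → A) :
    |val P f pol H 0 s0 - val Q f pol H 0 s0| ≤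
      (∑ h ∈ Finset.range H, ∑ s : S h, ∑ a : A, occ0 Q pol s0 h s a *
        min (H : ℝ) ((bp * H / 2) / (1 + ∑ i ∈ Finset.range n, occ0 Q (pols i) s0 h s a))) +
      (78 * (H : ℝ) ^ 3 / bp) * (∑ i ∈ Finset.range n, ∑ h ∈ Finset.range H, ∑ s : S h, ∑ a : A,
        occ0 P (pols i) s0 h s a * hellingerSq (P h s a) (Q h s a)) +
      (H : ℝ) ^ 2 / (2 * bp) := by
  have hHpos : (0 : ℝ) < H := by exact_mod_cast hH
  let e : ∀ h, S h → A → ℝ := fun h s a =>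
    ∑ s', (P h s a s' - Q h s a s') * val P f pol (H - (h + 1)) (h + 1) s'
  let g : ∀ h, S h → A → ℝ := fun h s a => (|e h s a| / H) ^ 2
  have hV : ∀ h, h < H → ∀ s', 0 ≤ val P f pol (H - (h + 1)) (h + 1) s' ∧
      val P f pol (H - (h + 1)) (h + 1) s' ≤ H := fun h hh s' => by
    have h1 := val_mem_Icc hP0 hP1 (fun h _ => hf h) pol (H - (h + 1)) (h + 1) (by omega) s'
    exact ⟨h1.1, h1.2.trans (by exact_mod_cast Nat.sub_le _ _)⟩
  have he : ∀ h, h < H → ∀ s a, |e h s a| ≤ H := fun h hh s a => by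
    have h1 := expect_mem_Icc (hP0 h hh s a) (hP1 h hh s a) (hV h hh)
    have h2 := expect_mem_Icc (hQ0 h hh s a) (hQ1 h hh s a) (hV h hh)
    simp only [e, sub_mul, Finset.sum_sub_distrib]
    rw [abs_le]
    constructor <;> linarith
  have hg0 : ∀ h s a, 0 ≤ g h s a := fun h s a => sq_nonneg _
  have hg1 : ∀ h, h < H → ∀ s a, 0 ≤ g h s a ∧ g h s a ≤ 1 := fun h hh s a =>
    ⟨hg0 h s a, pow_le_one₀ (by positivity) ((div_le_one hHpos).2 (he h hh s a))⟩
  have hgD : ∀ h, h < H → ∀ s a, g h s a ≤ 4 * hellingerSq (P h s a) (Q h s a) :=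
    fun h hh s a => by
      have h1 := sq_expect_sub_le (hP0 h hh s a) (hP1 h hh s a) (hQ0 h hh s a) (hQ1 h hh s a)
        (hV h hh)
      simp only [g, div_pow, sq_abs]
      rw [div_le_iff₀ (by positivity)]
      linarith
  have hq0 : ∀ pi : ∀ h, S h → A, ∀ h, h < H → ∀ s, 0 ≤ stateOcc0 Q pi s0 h s :=
    fun pi h hh => stateOcc0_nonneg hQ0 pi s0 h hh.le
  have hq1 : ∀ h, h < H → ∀ s, stateOcc0 Q pol s0 h s ≤ 1 := fun h hh s => by
    rw [← sum_stateOcc0 hQ1 pol s0 h hh.le]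
    exact Finset.single_le_sum (fun x _ => hq0 pol h hh x) (Finset.mem_univ s)
  have hocc : ∀ i h, h < H → ∀ s a, 0 ≤ occ0 Q (pols i) s0 h s a := fun i h hh s a => by
    unfold occ0
    split_ifs
    exacts [hq0 _ h hh s, le_rfl]
  let N : ∀ h, S h → A → ℝ := fun h s a => ∑ i ∈ Finset.range n, occ0 Q (pols i) s0 h s a
  have hN : ∀ h, h < H → ∀ s a, 0 ≤ N h s a := fun h hh s a =>
    Finset.sum_nonneg fun i _ => hocc i h hh s a
  let b : ∀ h, S h → A → ℝ := fun h s a => min (H : ℝ) ((bp * H / 2) / (1 + N h s a))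
  have hpast : ∀ i, ∑ h ∈ Finset.range H, ∑ s : S h, ∑ a : A,
      occ0 Q (pols i) s0 h s a * g h s a ≤ 18 * (H : ℝ) ^ 2 *
        ∑ h ∈ Finset.range H, ∑ s : S h, ∑ a : A,
          occ0 P (pols i) s0 h s a * hellingerSq (P h s a) (Q h s a) := fun i => by
    have h1 := val_le_pow_mul_val_hellingerSq hH hP0 hQ0 hQ1 hg1 hgD (pols i) H 0 (by simp) s0
    simp only [occ0_sum_eq]
    rw [val_eq_sum_stateOcc0, val_eq_sum_stateOcc0] at h1
    refine h1.2.trans (mul_le_mul_of_nonneg_right ?_ h1.1)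
    nlinarith [mul_le_mul_of_nonneg_right (one_add_one_div_pow_le_three H hH)
      (by positivity : 0 ≤ 6 * (H : ℝ) ^ 2)]
  have hD0 : 0 ≤ ∑ i ∈ Finset.range n, ∑ h ∈ Finset.range H, ∑ s : S h, ∑ a : A,
      occ0 P (pols i) s0 h s a * hellingerSq (P h s a) (Q h s a) := by
    simp only [occ0_sum_eq]
    exact Finset.sum_nonneg fun i _ => Finset.sum_nonneg fun h hh => Finset.sum_nonneg fun s _ =>
      mul_nonneg (stateOcc0_nonneg hP0 _ s0 h (Finset.mem_range.1 hh).le s)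
        (hellingerSq_nonneg _ _)
  have hNg : ∑ h ∈ Finset.range H, ∑ s : S h, ∑ a : A, N h s a * g h s a ≤
      18 * (H : ℝ) ^ 2 * ∑ i ∈ Finset.range n, ∑ h ∈ Finset.range H, ∑ s : S h, ∑ a : A,
        occ0 P (pols i) s0 h s a * hellingerSq (P h s a) (Q h s a) := by
    rw [Finset.mul_sum]
    refine le_trans (le_of_eq ?_) (Finset.sum_le_sum fun i _ => hpast i)
    refine Eq.trans ?_ Finset.sum_comm
    refine Finset.sum_congr rfl fun h _ => ?_
    refine Eq.trans ?_ Finset.sum_comm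
    refine Finset.sum_congr rfl fun s _ => ?_
    refine Eq.trans ?_ Finset.sum_comm
    exact Finset.sum_congr rfl fun a _ => Finset.sum_mul _ _ _
  have hpt : ∀ h, h < H → ∀ s : S h,
      stateOcc0 Q pol s0 h s * |e h s (pol h s)| ≤
        stateOcc0 Q pol s0 h s * b h s (pol h s) + (H : ℝ) / (2 * bp) *
          (stateOcc0 Q pol s0 h s + ∑ a : A, N h s a * g h s a) := fun h hh s => by
    have h1 := le_bonus_add_sq (he h hh s (pol h s)) hHpos hbp (hN h hh s (pol h s))
    have h2 := mul_le_mul_of_nonneg_left h1 (hq0 pol h hh s)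
    refine h2.trans ?_
    rw [mul_add]
    refine add_le_add le_rfl ?_
    rw [mul_left_comm]
    refine mul_le_mul_of_nonneg_left ?_ (by positivity)
    have hsingle : N h s (pol h s) * g h s (pol h s) ≤ ∑ a : A, N h s a * g h s a :=
      Finset.single_le_sum (f := fun a => N h s a * g h s a)
        (fun a _ => mul_nonneg (hN h hh s a) (hg0 h s a)) (Finset.mem_univ _)
    have h3 := mul_le_of_le_one_left
      (mul_nonneg (hN h hh s (pol h s)) (hg0 h s (pol h s))) (hq1 h hh s)
    have h4 := mul_le_of_le_one_right (hq0 pol h hh s) (hg1 h hh s (pol h s)).2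
    change stateOcc0 Q pol s0 h s * (g h s (pol h s) * (1 + N h s (pol h s))) ≤ _
    linarith
  have hmain : |val P f pol H 0 s0 - val Q f pol H 0 s0| ≤
      ∑ h ∈ Finset.range H, ∑ s : S h, stateOcc0 Q pol s0 h s * |e h s (pol h s)| := by
    rw [val_sub_val P Q f pol H H 0 (by simp), val_eq_sum_stateOcc0]
    refine (Finset.abs_sum_le_sum_abs _ _).trans (Finset.sum_le_sum fun h hh => ?_)
    refine (Finset.abs_sum_le_sum_abs _ _).trans (Finset.sum_le_sum fun s _ => ?_)
    rw [abs_mul, abs_of_nonneg (hq0 pol h (Finset.mem_range.1 hh) s)]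
  have htot : ∑ h ∈ Finset.range H, ∑ s : S h, stateOcc0 Q pol s0 h s = H := by
    calc _ = ∑ _h ∈ Finset.range H, (1 : ℝ) := Finset.sum_congr rfl fun h hh =>
          sum_stateOcc0 hQ1 pol s0 h (Finset.mem_range.1 hh).le
      _ = H := by simp
  have hsum := hmain.trans (Finset.sum_le_sum fun h hh =>
    Finset.sum_le_sum fun s _ => hpt h (Finset.mem_range.1 hh) s)
  simp only [Finset.sum_add_distrib, ← Finset.mul_sum] at hsum
  rw [htot] at hsum
  have hb : ∑ h ∈ Finset.range H, ∑ s : S h, ∑ a : A, occ0 Q pol s0 h s a *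
        min (H : ℝ) ((bp * H / 2) / (1 + ∑ i ∈ Finset.range n, occ0 Q (pols i) s0 h s a)) =
      ∑ h ∈ Finset.range H, ∑ s : S h, stateOcc0 Q pol s0 h s * b h s (pol h s) :=
    Finset.sum_congr rfl fun h _ => Finset.sum_congr rfl fun s _ =>
      occ0_sum_eq Q pol s0 h s (b h s)
  rw [hb]
  have hfin := bonus_residual_le hHpos hbp hNg hD0
  linarith

/-- Confidence bound for dynamics approximation w.r.t. the true rewards
(`lemma:CB-dynamics-true-r-main`). -/
theorem stmt9
    (H : ℕ) (hH : 1 ≤ H)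
    (s0 : S 0) (hS0 : ∀ s : S 0, s = s0)
    (D : C → ℝ) (hD0 : ∀ c, 0 ≤ D c) (hD1 : (∑ c, D c) = 1)
    (t : ℕ) (ht : 1 ≤ t) (bp : ℝ) (hbp : 0 < bp)
    (fstar : C → ∀ h, S h → A → ℝ)
    (hfstar : ∀ c h s a, 0 ≤ fstar c h s a ∧ fstar c h s a ≤ 1)
    (Pstar Phat : C → ∀ h, S h → A → S (h + 1) → ℝ)
    (hPstar0 : ∀ c h, h < H → ∀ s a s', 0 ≤ Pstar c h s a s')
    (hPstar1 : ∀ c h, h < H → ∀ s a, (∑ s', Pstar c h s a s') = 1)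
    (hPhat0 : ∀ c h, h < H → ∀ s a s', 0 ≤ Phat c h s a s')
    (hPhat1 : ∀ c h, h < H → ∀ s a, (∑ s', Phat c h s a s') = 1)
    (pols : ℕ → C → ∀ h, S h → A) :
    ∀ pol : C → ∀ h, S h → A,
      |∑ c, D c * (val (Pstar c) (fstar c) (pol c) H 0 s0 -
          val (Phat c) (fstar c) (pol c) H 0 s0)| ≤
        (∑ c, D c * ∑ h ∈ Finset.range H, ∑ s : S h, ∑ a : A,
            occ0 (Phat c) (pol c) s0 h s a * bonusP Phat pols s0 t bp H c h s a) +
        (78 * (H : ℝ) ^ 3 / bp) *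
          (∑ c, D c * ∑ i ∈ Finset.range (t - 1), ∑ h ∈ Finset.range H,
            ∑ s : S h, ∑ a : A,
              occ0 (Pstar c) (pols i c) s0 h s a *
                hellingerSq (Pstar c h s a) (Phat c h s a)) +
        (H : ℝ) ^ 2 / (2 * bp) := by
  intro pol
  refine (Finset.abs_sum_le_sum_abs _ _).trans ?_
  have hc : ∀ c, _ := fun c => mul_le_mul_of_nonneg_left
    (abs_val_sub_val_le hH s0 (t - 1) hbp (hfstar c) (hPstar0 c) (hPstar1 c) (hPhat0 c) (hPhat1 c)
      (fun i => pols i c) (pol c)) (hD0 c)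
  refine (Finset.sum_le_sum fun c _ => (?_ : _ ≤ _)).trans
    ((Finset.sum_le_sum fun c _ => hc c).trans (le_of_eq ?_))
  · rw [abs_mul, abs_of_nonneg (hD0 c)]
  · simp only [mul_add, Finset.sum_add_distrib, mul_left_comm (D _) (78 * (H : ℝ) ^ 3 / bp)]
    rw [← Finset.mul_sum, ← Finset.sum_mul, hD1, one_mul]
    rfl

end
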